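/- arXiv:1909.03440 — 8 statements merged into one kernel-verified Lean document; each statement's English description precedes it below -/
import Mathlib

section
/- Let R be a ring and let N and K be Rickart right R-modules. Then N and K are d-subisomorphic to each other if and only if there exist a surjective R-module homomorphism from N onto K and a surjective R-module homomorphism from K onto N. -/
universe u v w

section Defs

variable (R : Type u) [Ring R]

/-- A submodule `N` of `M` is a direct summand of `M`. -/
def IsDirectSummand {M : Type v} [AddCommGroup M] [Module R M] (N : Submodule R M) : Prop :=
  ∃ N' : Submodule R M, IsCompl N N'

/-- `N` is isomorphic (as an `R`-module) to a direct summand of `K`. -/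
def IsoToDirectSummand (N : Type*) [AddCommGroup N] [Module R N]
    (K : Type*) [AddCommGroup K] [Module R K] : Prop :=
  ∃ L : Submodule R K, IsDirectSummand R L ∧ Nonempty (N ≃ₗ[R] L)

/-- `N` and `K` are d-subisomorphic to each other. -/
def DSubisomorphic (N : Type*) [AddCommGroup N] [Module R N]
    (K : Type*) [AddCommGroup K] [Module R K] : Prop :=
  IsoToDirectSummand R N K ∧ IsoToDirectSummand R K N

/-- `N` and `K` are subisomorphic to each other: each embeds in the other. -/
def Subisomorphic (N : Type*) [AddCommGroup N] [Module R N]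
    (K : Type*) [AddCommGroup K] [Module R K] : Prop :=
  (∃ f : N →ₗ[R] K, Function.Injective f) ∧ (∃ g : K →ₗ[R] N, Function.Injective g)

/-- A module is Rickart if kernels of endomorphisms are direct summands. -/
def IsRickartModule (M : Type v) [AddCommGroup M] [Module R M] : Prop :=
  ∀ f : Module.End R M, IsDirectSummand R (LinearMap.ker f)

/-- A module is Baer if for every submodule `N`, the annihilator of `N` in the
endomorphism ring `S` is generated, as a left ideal of `S`, by an idempotent. -/
def IsBaerModule (M : Type v) [AddCommGroup M] [Module R M] : Prop :=
  ∀ N : Submodule R M, ∃ e : Module.End R M, IsIdempotentElem e ∧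
    ∀ f : Module.End R M, (∀ x ∈ N, f x = 0) ↔ ∃ g : Module.End R M, f = g * e

/-- A module is dual Rickart if images of endomorphisms are direct summands. -/
def IsDualRickartModule (M : Type v) [AddCommGroup M] [Module R M] : Prop :=
  ∀ f : Module.End R M, IsDirectSummand R (LinearMap.range f)

/-- A module is dual Baer if for every submodule `N`, the set of endomorphisms with
image contained in `N` is generated, as a right ideal of the endomorphism ring, by
an idempotent. -/
def IsDualBaerModule (M : Type v) [AddCommGroup M] [Module R M] : Prop :=
  ∀ N : Submodule R M, ∃ e : Module.End R M, IsIdempotentElem e ∧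
    ∀ f : Module.End R M, (LinearMap.range f ≤ N) ↔ ∃ g : Module.End R M, f = e * g

/-- `M` satisfies the Schröder–Bernstein (SB) property: d-subisomorphic direct summands
of `M` are isomorphic. -/
def SatisfiesSB (M : Type v) [AddCommGroup M] [Module R M] : Prop :=
  ∀ A B : Submodule R M, IsDirectSummand R A → IsDirectSummand R B →
    DSubisomorphic R A B → Nonempty (A ≃ₗ[R] B)

/-- `N` is an essential submodule of `D` (inside the ambient module `M`). -/
def IsEssentialIn {M : Type v} [AddCommGroup M] [Module R M] (N D : Submodule R M) : Prop :=
  N ≤ D ∧ ∀ L : Submodule R M, L ≤ D → L ⊓ N = ⊥ → L = ⊥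

/-- A module is extending if every submodule is essential in a direct summand. -/
def IsExtendingModule (M : Type v) [AddCommGroup M] [Module R M] : Prop :=
  ∀ N : Submodule R M, ∃ D : Submodule R M, IsDirectSummand R D ∧ IsEssentialIn R N D

/-- An ideal of `R` is essential if it intersects every nonzero ideal nontrivially. -/
def IsEssentialIdeal (I : Submodule R R) : Prop :=
  ∀ J : Submodule R R, J ⊓ I = ⊥ → J = ⊥

/-- The annihilator of an element of a module, as an ideal of `R`. -/
def annihilatorOf {M : Type v} [AddCommGroup M] [Module R M] (m : M) : Submodule R R :=
  LinearMap.ker (LinearMap.toSpanSingleton R M m)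

/-- An element is singular if its annihilator is an essential ideal. -/
def IsSingularElem {M : Type v} [AddCommGroup M] [Module R M] (m : M) : Prop :=
  IsEssentialIdeal R (annihilatorOf R m)

/-- A module is singular if all of its elements are singular, i.e. `Z(M) = M`. -/
def IsSingularModule (M : Type v) [AddCommGroup M] [Module R M] : Prop :=
  ∀ m : M, IsSingularElem R m

/-- A module is nonsingular if only zero is singular, i.e. `Z(M) = 0`. -/
def IsNonsingularModule (M : Type v) [AddCommGroup M] [Module R M] : Prop :=
  ∀ m : M, IsSingularElem R m → m = 0

/-- A subset of `R` is essential if it meets every nonzero ideal nontrivially. -/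
def IsEssentialSet (A : Set R) : Prop :=
  ∀ J : Submodule R R, J ≠ ⊥ → ∃ x ∈ J, x ≠ 0 ∧ x ∈ A

/-- `m` belongs to the second singular submodule `Z₂(M)`: the annihilator of the image
of `m` in `M/Z(M)` is essential. -/
def IsZ2Elem {M : Type v} [AddCommGroup M] [Module R M] (m : M) : Prop :=
  IsEssentialSet R {r : R | IsSingularElem R (r • m)}

/-- The second singular ideal `Z₂(R)` of `R`, as a two-sided ideal. -/
def secondSingularIdeal : TwoSidedIdeal R :=
  TwoSidedIdeal.span {r : R | IsZ2Elem R r}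

/-- The quotient ring `R / Z₂(R)`. -/
def QuotBySecondSingular : Type u := (secondSingularIdeal R).ringCon.Quotient

noncomputable instance : Ring (QuotBySecondSingular R) :=
  inferInstanceAs (Ring (secondSingularIdeal R).ringCon.Quotient)

/-- `M` has finite uniform dimension: it contains no infinite direct sum of nonzero
submodules. -/
def HasFiniteUniformDim (M : Type v) [AddCommGroup M] [Module R M] : Prop :=
  ¬ ∃ f : ℕ → Submodule R M, (∀ n, f n ≠ ⊥) ∧ iSupIndep f

end Defs

theorem isoToDirectSummand_of_leftInverse {R : Type*} [Ring R]
    {N : Type*} [AddCommGroup N] [Module R N] {K : Type*} [AddCommGroup K] [Module R K]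
    (i : N →ₗ[R] K) (g : K →ₗ[R] N) (h : ∀ x, g (i x) = x) : IsoToDirectSummand R N K := by
  refine ⟨LinearMap.range i, ⟨LinearMap.ker g, ?_⟩,
    ⟨LinearEquiv.ofInjective i (Function.LeftInverse.injective h)⟩⟩
  rw [isCompl_iff, disjoint_iff, codisjoint_iff]
  constructor
  · rw [eq_bot_iff]
    rintro _ ⟨⟨x, rfl⟩, hx⟩
    have hx' : g (i x) = 0 := hx
    rw [h] at hx'
    simp [hx']
  · rw [eq_top_iff]
    intro y _
    refine Submodule.mem_sup.2 ⟨i (g y), ⟨g y, rfl⟩, y - i (g y), ?_, by abel⟩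
    simp [h]

theorem epi_splits_of_rickart {R : Type*} [Ring R]
    {N : Type*} [AddCommGroup N] [Module R N] (hN : IsRickartModule R N)
    (p : Module.End R N) (hp : Function.Surjective p) :
    ∃ s : N →ₗ[R] N, ∀ x, p (s x) = x := by
  obtain ⟨C, hC⟩ := hN p
  have hb : Function.Bijective (p.domRestrict C) := by
    constructor
    · rw [injective_iff_map_eq_zero]
      rintro ⟨x, hx⟩ h0
      have h1 : x ∈ LinearMap.ker p ⊓ C := ⟨h0, hx⟩
      rw [hC.inf_eq_bot] at h1
      exact Subtype.ext h1
    · intro y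
      obtain ⟨x, rfl⟩ := hp y
      have hx : x ∈ LinearMap.ker p ⊔ C := by rw [hC.sup_eq_top]; trivial
      obtain ⟨a, ha, c, hc, rfl⟩ := Submodule.mem_sup.1 hx
      refine ⟨⟨c, hc⟩, ?_⟩
      have ha' : p a = 0 := ha
      simp [ha']
  refine ⟨C.subtype ∘ₗ (LinearEquiv.ofBijective _ hb).symm.toLinearMap, fun x => ?_⟩
  exact (LinearEquiv.ofBijective _ hb).apply_symm_apply x

theorem epi_of_isoToDirectSummand {R : Type*} [Ring R]
    {N : Type*} [AddCommGroup N] [Module R N] {K : Type*} [AddCommGroup K] [Module R K]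
    (h : IsoToDirectSummand R N K) : ∃ g : K →ₗ[R] N, Function.Surjective g := by
  obtain ⟨L, ⟨L', hL⟩, ⟨e⟩⟩ := h
  refine ⟨e.symm.toLinearMap ∘ₗ L.projectionOnto L' hL, ?_⟩
  intro y
  refine ⟨(e y : K), ?_⟩
  simp

theorem isoToDirectSummand_of_epis {R : Type*} [Ring R]
    {N : Type*} [AddCommGroup N] [Module R N] {K : Type*} [AddCommGroup K] [Module R K]
    (hN : IsRickartModule R N)
    (f : N →ₗ[R] K) (hf : Function.Surjective f) (g : K →ₗ[R] N) (hg : Function.Surjective g) :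
    IsoToDirectSummand R N K := by
  obtain ⟨s, hs⟩ := epi_splits_of_rickart hN (g ∘ₗ f) (hg.comp hf)
  exact isoToDirectSummand_of_leftInverse (f ∘ₗ s) g hs

/-- Two Rickart modules are d-subisomorphic to each other iff there are
surjective `R`-module homomorphisms from each onto the other. -/
theorem rickart_dSubisomorphic_iff_mutual_epis
    (R : Type u) [Ring R]
    (N : Type v) [AddCommGroup N] [Module R N]
    (K : Type w) [AddCommGroup K] [Module R K]
    (hN : IsRickartModule R N) (hK : IsRickartModule R K) :
    DSubisomorphic R N K ↔
      (∃ f : N →ₗ[R] K, Function.Surjective f) ∧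
      (∃ g : K →ₗ[R] N, Function.Surjective g) := by
  constructor
  · rintro ⟨h1, h2⟩
    exact ⟨epi_of_isoToDirectSummand h2, epi_of_isoToDirectSummand h1⟩
  · rintro ⟨⟨f, hf⟩, ⟨g, hg⟩⟩
    exact ⟨isoToDirectSummand_of_epis hN f hf g hg, isoToDirectSummand_of_epis hK g hg f hf⟩
end

section
/- Let R be a ring and let N and K be Baer right R-modules that are d-subisomorphic to each other. If for all idempotents g, h ∈ End_R(N), gh = 0 implies hg = 0, then N ≅ K. -/
universe u v w

theorem exists_section_of_isoToDirectSummand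
    (R : Type u) [Ring R]
    (N : Type v) [AddCommGroup N] [Module R N]
    (K : Type w) [AddCommGroup K] [Module R K]
    (h : IsoToDirectSummand R N K) :
    ∃ (i : N →ₗ[R] K) (p : K →ₗ[R] N), ∀ x, p (i x) = x := by
  obtain ⟨L, ⟨L', hL⟩, ⟨e⟩⟩ := h
  refine ⟨L.subtype ∘ₗ e.toLinearMap,
    e.symm.toLinearMap ∘ₗ L.projectionOnto L' hL, fun x => ?_⟩
  simp

theorem mul_eq_one_of_reversible_idem {S : Type*} [Ring S]
    (hidem : ∀ g h : S, IsIdempotentElem g → IsIdempotentElem h → g * h = 0 → h * g = 0)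
    (a b : S) (hba : b * a = 1) : a * b = 1 := by
  have hu : a * b * (a * b) = a * b := by
    rw [mul_assoc, ← mul_assoc b, hba, one_mul]
  have hua : a * b * a = a := by rw [mul_assoc, hba, mul_one]
  have hwa : (1 - a * b) * a = 0 := by rw [sub_mul, hua, one_mul, sub_self]
  have hwu : (1 - a * b) * (a * b) = 0 := by rw [← mul_assoc, hwa, zero_mul]
  have hw : IsIdempotentElem (1 - a * b) := by
    unfold IsIdempotentElem
    rw [mul_sub, mul_one, hwu, sub_zero]
  have huw : a * b * (1 - a * b) = 0 := by rw [mul_sub, mul_one, hu, sub_self]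
  generalize hwdef : 1 - a * b = c at *
  have hh : IsIdempotentElem (a * b + a * c) := by
    unfold IsIdempotentElem
    have h1 : a * b * (a * c) = a * c := by rw [← mul_assoc, hua]
    have h2 : a * c * (a * b) = 0 := by rw [mul_assoc, hwu, mul_zero]
    have h3 : a * c * (a * c) = 0 := by
      rw [mul_assoc, ← mul_assoc c, hwa, zero_mul, mul_zero]
    rw [add_mul, mul_add, mul_add, hu, h1, h2, h3, add_zero, add_zero]
  have h0 : c * (a * b + a * c) = 0 := by
    rw [mul_add, hwu, ← mul_assoc, hwa, zero_mul, add_zero]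
  have h1 := hidem _ _ hw hh h0
  rw [add_mul, huw, zero_add, mul_assoc, hw.eq] at h1
  have hc : c = 0 := by
    calc c = b * (a * c) := by rw [← mul_assoc, hba, one_mul]
      _ = 0 := by rw [h1, mul_zero]
  rw [hc] at hwdef
  exact (sub_eq_zero.mp hwdef).symm

/-- d-subisomorphic Baer modules are isomorphic, provided that for all
idempotent endomorphisms `g, h` of `N`, `g * h = 0` implies `h * g = 0`. -/
theorem baer_dSubisomorphic_isomorphic
    (R : Type u) [Ring R]
    (N : Type v) [AddCommGroup N] [Module R N]
    (K : Type w) [AddCommGroup K] [Module R K]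
    (hN : IsBaerModule R N) (hK : IsBaerModule R K)
    (hd : DSubisomorphic R N K)
    (hidem : ∀ g h : Module.End R N,
      IsIdempotentElem g → IsIdempotentElem h → g * h = 0 → h * g = 0) :
    Nonempty (N ≃ₗ[R] K) := by
  obtain ⟨i, p, hpi⟩ := exists_section_of_isoToDirectSummand R N K hd.1
  obtain ⟨j, q, hqj⟩ := exists_section_of_isoToDirectSummand R K N hd.2
  have hab := mul_eq_one_of_reversible_idem hidem (j ∘ₗ i) (p ∘ₗ q)
    (by ext x; simp [hqj, hpi])
  refine ⟨(LinearEquiv.ofBijective j ⟨Function.LeftInverse.injective hqj, fun x => ?_⟩).symm⟩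
  exact ⟨i (p (q x)), by simpa using LinearMap.congr_fun hab x⟩
end

section
/- Every duo Baer right R-module satisfies the SB property. In particular, every right duo Baer ring satisfies the SB property. -/
universe u v

/-- A module is duo if every submodule is fully invariant. -/
def IsDuoModule (R : Type u) [Ring R] (M : Type v) [AddCommGroup M] [Module R M] : Prop :=
  ∀ (N : Submodule R M) (f : Module.End R M), N.map f ≤ N

/-- In a duo module, a submodule isomorphic to a direct summand of a direct summand `B`
is contained in `B`. -/
theorem le_of_duo {R : Type u} [Ring R] {M : Type v} [AddCommGroup M] [Module R M]
    (hM : IsDuoModule R M) (A B : Submodule R M) (hB : IsDirectSummand R B)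
    (h : IsoToDirectSummand R A B) : A ≤ B := by
  obtain ⟨B', hB⟩ := hB
  obtain ⟨L, ⟨L', hL⟩, ⟨e⟩⟩ := h
  intro a ha
  let g : Module.End R M := A.subtype ∘ₗ e.symm.toLinearMap ∘ₗ
    L.projectionOnto L' hL ∘ₗ B.projectionOnto B' hB
  have h1 : g ((e ⟨a, ha⟩ : B) : M) = a := by
    simp [g]
  have h2 := hM B g (Submodule.mem_map_of_mem (f := g) (e ⟨a, ha⟩ : B).2)
  rwa [h1] at h2

theorem sb_of_duo (R : Type u) [Ring R] (M : Type v) [AddCommGroup M] [Module R M]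
    (hM : IsDuoModule R M) : SatisfiesSB R M := by
  intro A B hA hB h
  exact ⟨LinearEquiv.ofEq A B (le_antisymm (le_of_duo hM A B hB h.1) (le_of_duo hM B A hA h.2))⟩

/-- Every duo Baer module satisfies the SB property; in particular, every
duo Baer ring (i.e. a ring which is duo and Baer as a module over itself) satisfies
the SB property. -/
theorem duo_baer_satisfiesSB :
    (∀ (R : Type u) [Ring R] (M : Type v) [AddCommGroup M] [Module R M],
        IsDuoModule R M → IsBaerModule R M → SatisfiesSB R M) ∧
    (∀ (R : Type u) [Ring R],
        IsDuoModule R R → IsBaerModule R R → SatisfiesSB R R) := by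
  exact ⟨fun R _ M _ _ h _ => sb_of_duo R M h, fun R _ h _ => sb_of_duo R R h⟩
end

section
/- Every commutative Baer ring satisfies the SB property. -/
universe u v

/-- A Baer ring: the right annihilator of every nonempty subset is generated,
as a right ideal, by an idempotent. -/
def IsBaerRing (R : Type u) [Ring R] : Prop :=
  ∀ A : Set R, A.Nonempty → ∃ e : R, IsIdempotentElem e ∧
    ∀ r : R, (∀ a ∈ A, a * r = 0) ↔ ∃ s : R, r = e * s

/-- A submodule of a commutative ring embedding in a direct summand is contained in it. -/
theorem le_of_embeds_summand (R : Type u) [CommRing R] (A B : Submodule R R)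
    (hA : IsDirectSummand R A) (h : IsoToDirectSummand R B A) : B ≤ A := by
  obtain ⟨A', hc⟩ := hA
  obtain ⟨L, -, ⟨φ⟩⟩ := h
  obtain ⟨e, he, e', he', h1⟩ := Submodule.mem_sup.1
    (show (1 : R) ∈ A ⊔ A' by rw [hc.sup_eq_top]; trivial)
  have hann : ∀ a ∈ A, e' * a = 0 := fun a ha => by
    have h2 : e' * a ∈ A ⊓ A' :=
      ⟨A.smul_mem e' ha, by rw [mul_comm]; exact A'.smul_mem a he'⟩
    rw [hc.inf_eq_bot] at h2
    simpa using h2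
  intro b hb
  have h3 : e' • (⟨b, hb⟩ : B) = 0 := by
    apply φ.injective
    rw [map_smul, map_zero]
    ext
    exact hann _ (φ ⟨b, hb⟩).1.2
  have h4 : e' * b = 0 := congrArg Subtype.val h3
  have h5 : b = b * e := by
    calc b = (e + e') * b := by rw [h1, one_mul]
      _ = b * e := by rw [add_mul, h4, add_zero, mul_comm]
  rw [h5]
  exact A.smul_mem b he

/-- Every commutative Baer ring satisfies the SB property. -/
theorem comm_baer_ring_satisfiesSB (R : Type u) [CommRing R] (hB : IsBaerRing R) :
    SatisfiesSB R R := by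
  intro A B hA hB' h
  have hAB : A = B :=
    le_antisymm (le_of_embeds_summand R B A hB' h.1) (le_of_embeds_summand R A B hA h.2)
  exact ⟨LinearEquiv.ofEq A B hAB⟩
end

section
/- If M is a Baer right R-module with only countably many direct summands, then M satisfies the SB property. -/
universe u v

theorem aux_orth {S : Type*} [Ring S] (h k : S) (hk : k * h = 1) (hne : h * k ≠ 1) :
    ∃ e : ℕ → S, (∀ n, e n ≠ 0) ∧ (∀ n, e n * e n = e n) ∧ ∀ n m, n ≠ m → e n * e m = 0 := by
  have hpow : ∀ n, k ^ n * h ^ n = 1 := by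
    intro n
    induction n with
    | zero => simp
    | succ n ih =>
      calc k ^ (n+1) * h ^ (n+1) = k ^ n * (k * h) * h ^ n := by
            rw [pow_succ, pow_succ']; simp only [mul_assoc]
        _ = 1 := by rw [hk, mul_one, ih]
  obtain ⟨p, hp⟩ : ∃ p, p = 1 - h * k := ⟨_, rfl⟩
  have kp : k * p = 0 := by rw [hp, mul_sub, ← mul_assoc, hk]; simp
  have ph : p * h = 0 := by rw [hp, sub_mul, mul_assoc, hk]; simp
  have pp : p * p = p := by
    nth_rewrite 1 [hp]
    rw [sub_mul, mul_assoc, kp]; simp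
  have p0 : p ≠ 0 := by
    intro h0
    rw [h0] at hp
    exact hne (sub_eq_zero.mp hp.symm).symm
  refine ⟨fun n => h ^ n * p * k ^ n, ?_, ?_, ?_⟩
  · intro n h0
    apply p0
    have : k ^ n * (h ^ n * p * k ^ n) * h ^ n = (k ^ n * h ^ n) * p * (k ^ n * h ^ n) := by
      simp only [mul_assoc]
    simp only at h0
    rw [h0, hpow] at this
    simpa using this.symm
  · intro n
    have : (h ^ n * p * k ^ n) * (h ^ n * p * k ^ n) = h ^ n * (p * (k ^ n * h ^ n) * p) * k ^ n := by
      simp only [mul_assoc]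
    simp only
    rw [this, hpow, mul_one, pp]
  · intro n m hnm
    have : (h ^ n * p * k ^ n) * (h ^ m * p * k ^ m) = h ^ n * (p * (k ^ n * h ^ m) * p) * k ^ m := by
      simp only [mul_assoc]
    simp only
    rw [this]
    have key : p * (k ^ n * h ^ m) * p = 0 := by
      rcases lt_or_gt_of_ne hnm with hl | hl
      · obtain ⟨d, rfl⟩ := Nat.exists_eq_add_of_lt hl
        have : k ^ n * h ^ (n + d + 1) = h * h ^ d := by
          rw [add_assoc, pow_add, ← mul_assoc, hpow, one_mul, pow_succ']
        rw [this, ← mul_assoc, ph]; simp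
      · obtain ⟨d, rfl⟩ := Nat.exists_eq_add_of_lt hl
        have : k ^ (m + d + 1) * h ^ m = k ^ d * k := by
          rw [add_assoc, add_comm, pow_add, mul_assoc, hpow, mul_one, pow_succ]
        rw [this, mul_assoc, mul_assoc, kp]; simp
    rw [key]; simp

theorem aux_uncount (R : Type u) [Ring R] (M : Type v) [AddCommGroup M] [Module R M]
    (hB : IsBaerModule R M)
    (hc : {N : Submodule R M | IsDirectSummand R N}.Countable)
    (e : ℕ → Module.End R M) (e0 : ∀ n, e n ≠ 0) (ee : ∀ n, e n * e n = e n)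
    (eo : ∀ n m, n ≠ m → e n * e m = 0) : False := by
  choose ε hid hε using fun S : Set ℕ => hB (⨆ n ∈ S, LinearMap.range (e n))
  have hsub : ∀ S T : Set ℕ, LinearMap.ker (ε S) = LinearMap.ker (ε T) → S ⊆ T := by
    intro S T hST n hn
    by_contra hnT
    have h1 : ∀ x ∈ (⨆ n ∈ T, LinearMap.range (e n)), e n x = 0 := by
      have : (⨆ n ∈ T, LinearMap.range (e n)) ≤ LinearMap.ker (e n) := by
        refine iSup₂_le fun m hm => ?_
        rintro _ ⟨y, rfl⟩
        have := eo n m (fun h => hnT (h ▸ hm))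
        exact LinearMap.congr_fun this y
      exact this
    obtain ⟨g, hg⟩ := (hε T (e n)).1 h1
    have h2 := (hε S (ε S)).2 ⟨1, by simp⟩
    apply e0 n
    ext x
    have h3 : e n x ∈ LinearMap.ker (ε S) :=
      h2 _ ((le_iSup₂_of_le (f := fun n (_ : n ∈ S) => LinearMap.range (e n)) n hn le_rfl) ⟨x, rfl⟩)
    rw [hST, LinearMap.mem_ker] at h3
    have h4 : e n (e n x) = e n x := LinearMap.congr_fun (ee n) x
    rw [← h4]
    have h5 : e n (e n x) = g (ε T (e n x)) := LinearMap.congr_fun hg (e n x)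
    rw [h5, h3]; simp
  have hinj : Function.Injective
      (fun S : Set ℕ => (⟨LinearMap.ker (ε S), (LinearMap.range (ε S)),
        (LinearMap.IsIdempotentElem.isCompl (hid S)).symm⟩ :
        {N : Submodule R M | IsDirectSummand R N})) := by
    intro S T h
    have h := congrArg Subtype.val h
    exact Set.Subset.antisymm (hsub S T h) (hsub T S h.symm)
  have := hc.to_subtype
  have hcs : Countable (Set ℕ) := hinj.countable
  obtain ⟨f, hf⟩ := hcs.exists_injective_nat
  exact Function.cantor_injective f hf

theorem aux_split (R : Type u) [Ring R] {N K : Type*} [AddCommGroup N] [Module R N]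
    [AddCommGroup K] [Module R K] (h : IsoToDirectSummand R N K) :
    ∃ (f : N →ₗ[R] K) (f' : K →ₗ[R] N), f' ∘ₗ f = LinearMap.id := by
  obtain ⟨L, ⟨L', hL⟩, ⟨φ⟩⟩ := h
  refine ⟨L.subtype ∘ₗ φ.toLinearMap, φ.symm.toLinearMap ∘ₗ L.projectionOnto L' hL, ?_⟩
  ext x
  simp

/-- A Baer module with only countably many direct summands satisfies
the SB property. -/
theorem baer_countable_summands_satisfiesSB
    (R : Type u) [Ring R] (M : Type v) [AddCommGroup M] [Module R M]
    (hB : IsBaerModule R M)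
    (hc : {N : Submodule R M | IsDirectSummand R N}.Countable) :
    SatisfiesSB R M := by
  rintro A B ⟨A', hA⟩ - ⟨h1, h2⟩
  obtain ⟨f, f', hf⟩ := aux_split R h1
  obtain ⟨g, g', hg⟩ := aux_split R h2
  have hf1 : ∀ x, f' (f x) = x := fun x => LinearMap.congr_fun hf x
  have hg1 : ∀ x, g' (g x) = x := fun x => LinearMap.congr_fun hg x
  have hk : (f' ∘ₗ g' : Module.End R A) * (g ∘ₗ f : Module.End R A) = 1 := by
    apply LinearMap.ext; intro x
    simp [hf1, hg1]
  by_cases hne : (g ∘ₗ f : Module.End R A) * (f' ∘ₗ g' : Module.End R A) = 1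
  · refine ⟨(LinearEquiv.ofBijective g ⟨Function.LeftInverse.injective hg1, fun y => ?_⟩).symm⟩
    exact ⟨f (f' (g' y)), LinearMap.congr_fun hne y⟩
  · exfalso
    obtain ⟨e, e0, ee, eo⟩ := aux_orth _ _ hk hne
    let π := A.projectionOnto A' hA
    have hπ : ∀ x : A, π x = x := fun x => by simp [π]
    refine aux_uncount R M hB hc (fun n => A.subtype ∘ₗ e n ∘ₗ π) ?_ ?_ ?_
    · intro n h0
      apply e0 n
      apply LinearMap.ext; intro x
      have := LinearMap.congr_fun h0 (x : M)
      simpa [hπ] using this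
    · intro n
      apply LinearMap.ext; intro x
      have := LinearMap.congr_fun (ee n) (π x)
      simp only [Module.End.mul_apply] at this
      simp [hπ, this]
    · intro n m hnm
      apply LinearMap.ext; intro x
      have := LinearMap.congr_fun (eo n m hnm) (π x)
      simp only [Module.End.mul_apply] at this
      simp [hπ, this]
end

section
/- Let R be a ring such that any pair of Baer right R-modules that are subisomorphic to each other are isomorphic. Then every nonsingular extending right R-module is injective. -/
universe u v

section Aux

variable {R : Type u} [Ring R]

/-- `D` is the image of a projection. -/
def AuxRetr {P : Type u} [AddCommGroup P] [Module R P] (D : Submodule R P) : Prop :=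
  ∃ T : P →ₗ[R] P, (∀ p, T p ∈ D) ∧ ∀ p ∈ D, T p = p

/-- The quotient by `D` is nonsingular. -/
def AuxClosed {P : Type u} [AddCommGroup P] [Module R P] (D : Submodule R P) : Prop :=
  ∀ p : P, IsEssentialIdeal R (D.comap (LinearMap.toSpanSingleton R P p)) → p ∈ D

theorem aux_ess_mono {I J : Submodule R R} (hIJ : I ≤ J) (hI : IsEssentialIdeal R I) :
    IsEssentialIdeal R J := fun L hL =>
  hI L (le_bot_iff.mp (le_trans (inf_le_inf_left L hIJ) hL.le))

theorem aux_retr_of_summand {P : Type u} [AddCommGroup P] [Module R P] {D : Submodule R P}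
    (h : IsDirectSummand R D) : AuxRetr D := by
  obtain ⟨D', h⟩ := h
  exact ⟨D.projection D' h, fun p => Submodule.projection_apply_mem h p,
    fun p hp => Submodule.projection_apply_of_mem_left h hp⟩

theorem aux_extending_of_injective {F : Type u} [AddCommGroup F] [Module R F]
    (hF : Module.Injective R F) : IsExtendingModule R F := by
  intro N
  obtain ⟨E, -, hE⟩ := zorn_le_nonempty₀ {E : Submodule R F | IsEssentialIn R N E} (by
    intro c hc hch y hy
    refine ⟨sSup c, ⟨(hc hy).1.trans (le_sSup hy), ?_⟩, fun z hz => le_sSup hz⟩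
    intro L hL hLN
    rw [eq_bot_iff]
    intro x hx
    obtain ⟨E, hE, hxE⟩ := (Submodule.mem_sSup_of_directed ⟨y, hy⟩ hch.directedOn).1 (hL hx)
    have h1 : Submodule.span R {x} = ⊥ := (hc hE).2 _
      ((Submodule.span_singleton_le_iff_mem _ _).2 hxE)
      (le_bot_iff.mp (le_trans (inf_le_inf_right N
        ((Submodule.span_singleton_le_iff_mem _ _).2 hx)) hLN.le))
    simpa using h1) N ⟨le_rfl, fun L hL h => by rwa [inf_eq_left.2 hL] at h⟩
  obtain ⟨C, -, hC⟩ := zorn_le_nonempty₀ {C : Submodule R F | C ⊓ E = ⊥} (by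
    intro c hc hch y hy
    refine ⟨sSup c, ?_, fun z hz => le_sSup hz⟩
    change sSup c ⊓ E = ⊥
    rw [eq_bot_iff]
    rintro x ⟨hx, hxE⟩
    obtain ⟨C, hC, hxC⟩ := (Submodule.mem_sSup_of_directed ⟨y, hy⟩ hch.directedOn).1 hx
    have : C ⊓ E = ⊥ := hc hC
    rw [← this]
    exact ⟨hxC, hxE⟩) ⊥ (by simp)
  have hCE : C ⊓ E = ⊥ := hC.prop
  have hinj : Function.Injective (C.mkQ ∘ₗ E.subtype) := by
    rw [injective_iff_map_eq_zero]
    intro x hx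
    have hxC : (x : F) ∈ C := by simpa using hx
    have : (x : F) ∈ C ⊓ E := ⟨hxC, x.2⟩
    rw [hCE] at this
    simpa using this
  obtain ⟨g, hg⟩ := hF.out _ hinj E.subtype
  set T : F →ₗ[R] F := g ∘ₗ C.mkQ with hT
  have hTE : ∀ x ∈ E, T x = x := fun x hx => hg ⟨x, hx⟩
  have hTC : ∀ x ∈ C, T x = 0 := fun x hx => by
    have : C.mkQ x = 0 := by simpa using hx
    simp only [hT, LinearMap.comp_apply, this, map_zero]
  have hNE : IsEssentialIn R N E := hE.prop
  have hle : E ≤ LinearMap.range T := fun x hx => ⟨x, hTE x hx⟩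
  have hmem : IsEssentialIn R N (LinearMap.range T) := by
    refine ⟨hNE.1.trans hle, fun L hL hLN => ?_⟩
    have h1 : L ⊓ E = ⊥ := hNE.2 _ inf_le_right (le_bot_iff.mp
      (le_trans (inf_le_inf_right N inf_le_left) hLN.le))
    have h2 : L.comap T ⊓ E = ⊥ := by
      rw [eq_bot_iff]
      rintro x ⟨hx, hxE⟩
      rw [← h1]
      refine ⟨?_, hxE⟩
      have : T x ∈ L := hx
      rwa [hTE x hxE] at this
    have h3 : L.comap T ≤ C := hC.le_of_ge h2 (fun x hx => by
      change T x ∈ L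
      rw [hTC x hx]; exact L.zero_mem)
    rw [eq_bot_iff]
    intro y hy
    obtain ⟨x, rfl⟩ := hL hy
    exact hTC x (h3 hy)
  have hTr : LinearMap.range T ≤ E := hE.le_of_ge hmem hle
  refine ⟨E, ⟨LinearMap.ker (T.codRestrict E fun x => hTr ⟨x, rfl⟩), ?_⟩, hNE⟩
  exact LinearMap.isCompl_of_proj fun x => Subtype.ext (hTE x x.2)

/-- Closed submodules of extending modules are retracts. -/
theorem aux_retr_of_extending {P : Type u} [AddCommGroup P] [Module R P]
    (hP : IsExtendingModule R P) {D : Submodule R P} (hD : AuxClosed D) : AuxRetr D := by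
  obtain ⟨D₁, hs, hle, hess⟩ := hP D
  have : D₁ ≤ D := by
    intro x hx
    refine hD x fun J hJ => ?_
    have h1 : J.map (LinearMap.toSpanSingleton R P x) = ⊥ := by
      apply hess
      · rintro _ ⟨j, -, rfl⟩
        exact D₁.smul_mem j hx
      · rw [eq_bot_iff]
        rintro _ ⟨⟨j, hj, rfl⟩, hjD⟩
        have : j ∈ J ⊓ D.comap (LinearMap.toSpanSingleton R P x) := ⟨hj, hjD⟩
        rw [hJ] at this
        rw [(Submodule.mem_bot R).1 this, map_zero]
        exact Submodule.zero_mem _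
    rw [eq_bot_iff, ← hJ]
    intro j hj
    refine ⟨hj, ?_⟩
    have : LinearMap.toSpanSingleton R P x j ∈ J.map (LinearMap.toSpanSingleton R P x) :=
      ⟨j, hj, rfl⟩
    rw [h1, Submodule.mem_bot] at this
    change LinearMap.toSpanSingleton R P x j ∈ D
    rw [this]; exact D.zero_mem
  have heq : D₁ = D := le_antisymm this hle
  exact heq ▸ aux_retr_of_summand hs

theorem aux_closed_comap {P Q : Type u} [AddCommGroup P] [Module R P] [AddCommGroup Q]
    [Module R Q] (f : Q →ₗ[R] P) {D : Submodule R P} (hD : AuxClosed D) :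
    AuxClosed (D.comap f) := by
  intro q hq
  refine hD (f q) (aux_ess_mono (fun r hr => ?_) hq)
  simpa using hr

theorem aux_retr_prod {M F : Type u} [AddCommGroup M] [Module R M] [AddCommGroup F]
    [Module R F] (hM : IsExtendingModule R M) (hF : Module.Injective R F)
    {D : Submodule R (M × F)} (hD : AuxClosed D) : AuxRetr D := by
  obtain ⟨e, he1, he2⟩ := aux_retr_of_extending (aux_extending_of_injective hF)
    (aux_closed_comap (LinearMap.inr R M F) hD)
  let D' : Submodule R (M × F) := D ⊓ LinearMap.ker (e ∘ₗ LinearMap.snd R M F)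
  have hinj : Function.Injective (LinearMap.fst R M F ∘ₗ D'.subtype) := by
    rw [injective_iff_map_eq_zero]
    rintro ⟨⟨m, b⟩, hd, hk⟩ hm
    have hm : m = 0 := hm
    have hkb : e b = 0 := hk
    subst hm
    have : b = 0 := by rw [← he2 b hd, hkb]
    subst this
    rfl
  obtain ⟨φ, hφ⟩ := hF.out _ hinj (LinearMap.snd R M F ∘ₗ D'.subtype)
  obtain ⟨q, hq1, hq2⟩ := aux_retr_of_extending hM
    (aux_closed_comap (LinearMap.prod LinearMap.id φ) hD)
  have hX : ∀ m f, (m, f) ∈ D → (m, φ m) ∈ D := by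
    intro m f hmf
    have h1 : (m, f - e f) ∈ D := by
      have := D.sub_mem hmf (he1 f)
      simpa using this
    have h2 : (m, f - e f) ∈ D' := ⟨h1, by
      change e (f - e f) = 0
      rw [map_sub, he2 _ (he1 f), sub_self]⟩
    have h3 : φ m = f - e f := hφ ⟨_, h2⟩
    rwa [h3]
  refine ⟨LinearMap.prod (q ∘ₗ LinearMap.fst R M F)
    (φ ∘ₗ q ∘ₗ LinearMap.fst R M F +
      e ∘ₗ (LinearMap.snd R M F - φ ∘ₗ LinearMap.fst R M F)), ?_, ?_⟩
  · rintro ⟨m, f⟩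
    have h1 : (q m, φ (q m)) ∈ D := hq1 m
    have h2 : ((0 : M), e (f - φ m)) ∈ D := he1 _
    have := D.add_mem h1 h2
    simpa using this
  · rintro ⟨m, f⟩ hmf
    have h1 : q m = m := hq2 m (hX m f hmf)
    have h2 : e (f - φ m) = f - φ m := he2 _ (by
      have := D.sub_mem hmf (hX m f hmf)
      change ((0 : M), f - φ m) ∈ D
      simpa using this)
    refine Prod.ext ?_ ?_
    · exact h1
    · change φ (q m) + e (f - φ m) = f
      rw [h1, h2]; abel

theorem aux_baer {P : Type u} [AddCommGroup P] [Module R P] (hns : IsNonsingularModule R P)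
    (hP : ∀ D : Submodule R P, AuxClosed D → AuxRetr D) : IsBaerModule R P := by
  intro X
  let D : Submodule R P :=
    { carrier := {p | ∀ f : Module.End R P, (∀ x ∈ X, f x = 0) → f p = 0}
      add_mem' := fun {a b} ha hb f hf => by rw [map_add, ha f hf, hb f hf, add_zero]
      zero_mem' := fun f _ => map_zero f
      smul_mem' := fun r a ha f hf => by rw [map_smul, ha f hf, smul_zero] }
  have hXD : ∀ x ∈ X, x ∈ D := fun x hx f hf => hf x hx
  obtain ⟨T, hT1, hT2⟩ := hP D (fun p hp f hf => by
    refine hns _ (aux_ess_mono (fun r hr => ?_) hp)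
    have : f (r • p) = 0 := hr f hf
    change r • f p = 0
    rw [← map_smul, this])
  refine ⟨1 - T, ?_, fun f => ⟨fun hf => ⟨f, ?_⟩, ?_⟩⟩
  · refine LinearMap.ext fun p => ?_
    change (p - T p) - T (p - T p) = p - T p
    rw [map_sub, hT2 _ (hT1 p), sub_self, sub_zero]
  · refine LinearMap.ext fun p => ?_
    change f p = f (p - T p)
    rw [map_sub, hT1 p f hf, sub_zero]
  · rintro ⟨g, rfl⟩ x hx
    change g (x - T x) = 0
    rw [hT2 x (hXD x hx), sub_self, map_zero]

theorem aux_ann_le {P Q : Type u} [AddCommGroup P] [Module R P] [AddCommGroup Q]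
    [Module R Q] (f : P →ₗ[R] Q) (p : P) (hp : IsSingularElem R p) : IsSingularElem R (f p) := by
  refine aux_ess_mono (fun r hr => ?_) hp
  have : r • p = 0 := hr
  change r • f p = 0
  rw [← map_smul, this, map_zero]

theorem aux_singular_smul {P : Type u} [AddCommGroup P] [Module R P] (p : P) (r : R)
    (hp : IsSingularElem R p) : IsSingularElem R (r • p) := by
  intro J hJ
  have h1 : J.map (LinearMap.toSpanSingleton R R r) = ⊥ := by
    apply hp
    rw [eq_bot_iff]
    rintro _ ⟨⟨j, hj, rfl⟩, hjp⟩
    have hjp : (j * r) • p = 0 := hjp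
    have : j ∈ J ⊓ annihilatorOf R (r • p) := ⟨hj, by
      change j • r • p = 0
      rwa [← mul_smul]⟩
    rw [hJ] at this
    rw [(Submodule.mem_bot R).1 this, map_zero]
    exact Submodule.zero_mem _
  rw [eq_bot_iff, ← hJ]
  intro j hj
  refine ⟨hj, ?_⟩
  have : LinearMap.toSpanSingleton R R r j ∈ J.map (LinearMap.toSpanSingleton R R r) :=
    ⟨j, hj, rfl⟩
  rw [h1, Submodule.mem_bot] at this
  have : j * r = 0 := this
  change j • r • p = 0
  rw [← mul_smul, this, zero_smul]

theorem aux_inj_retract {M P : Type u} [AddCommGroup M] [Module R M] [AddCommGroup P]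
    [Module R P] (hP : Module.Injective R P) (i : M →ₗ[R] P) (s : P →ₗ[R] M)
    (hs : ∀ m, s (i m) = m) : Module.Injective R M := by
  refine ⟨fun X Y _ _ _ _ f hf g => ?_⟩
  obtain ⟨k, hk⟩ := hP.out f hf (i ∘ₗ g)
  refine ⟨s ∘ₗ k, fun x => ?_⟩
  rw [LinearMap.comp_apply, hk, LinearMap.comp_apply, hs]

open CategoryTheory in
theorem aux_enough (M : Type u) [AddCommGroup M] [Module R M] :
    ∃ (E : Type u) (_ : AddCommGroup E) (_ : Module R E) (i : M →ₗ[R] E),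
      Module.Injective R E ∧ Function.Injective i := by
  have := ModuleCat.enoughInjectives.{u} R
  let A : ModuleCat.{u} R := ModuleCat.of R M
  have h1 : Module.Injective R (Injective.under A : ModuleCat.{u} R) :=
    Module.injective_module_of_injective_object R _
      (inj := (inferInstance : Injective (Injective.under A)))
  exact ⟨(Injective.under A : ModuleCat.{u} R), inferInstance, inferInstance,
    (Injective.ι A).hom, h1, (ModuleCat.mono_iff_injective _).1 inferInstance⟩

theorem aux_hull (M : Type u) [AddCommGroup M] [Module R M] (hM : IsNonsingularModule R M) :
    ∃ (E : Type u) (_ : AddCommGroup E) (_ : Module R E) (i : M →ₗ[R] E),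
      Module.Injective R E ∧ Function.Injective i ∧ IsNonsingularModule R E := by
  obtain ⟨E, _, _, i, hE, hi⟩ := aux_enough (R := R) M
  obtain ⟨D, ⟨D', hc⟩, hle, hess⟩ := aux_extending_of_injective hE (LinearMap.range i)
  refine ⟨D, inferInstance, inferInstance, i.codRestrict D fun m => hle ⟨m, rfl⟩, ?_, ?_, ?_⟩
  · exact aux_inj_retract hE D.subtype (D.projectionOnto D' hc)
      (fun m => Submodule.projectionOnto_apply_left hc m)
  · intro a b hab
    exact hi (congrArg Subtype.val hab)
  · intro d hd
    have hd' : IsSingularElem R (d : E) := aux_ann_le D.subtype d hd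
    have h1 : Submodule.span R {(d : E)} = ⊥ := by
      apply hess
      · exact (Submodule.span_singleton_le_iff_mem _ _).2 d.2
      · rw [eq_bot_iff]
        rintro x ⟨hx, m, rfl⟩
        obtain ⟨r, hr⟩ := Submodule.mem_span_singleton.1 hx
        have h2 : IsSingularElem R (i m) := hr ▸ aux_singular_smul (d : E) r hd'
        have h3 : m = 0 := hM m (aux_ess_mono (fun s hs => by
          have : s • i m = 0 := hs
          rw [← map_smul] at this
          exact hi (this.trans (map_zero i).symm)) h2)
        rw [h3, map_zero]
        exact Submodule.zero_mem _
    exact Subtype.ext (by simpa using h1)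

end Aux

/-- If any pair of mutually subisomorphic Baer `R`-modules are isomorphic,
then every nonsingular extending `R`-module is injective. -/
theorem nonsingular_extending_injective_of_baer_SB
    (R : Type u) [Ring R]
    (h : ∀ (N : Type u) [AddCommGroup N] [Module R N]
        (K : Type u) [AddCommGroup K] [Module R K],
        IsBaerModule R N → IsBaerModule R K → Subisomorphic R N K →
        Nonempty (N ≃ₗ[R] K)) :
    ∀ (M : Type u) [AddCommGroup M] [Module R M],
      IsNonsingularModule R M → IsExtendingModule R M → Module.Injective R M := by
  intro M _ _ hns hext
  obtain ⟨E, _, _, i, hE, hi, hEns⟩ := aux_hull (R := R) M hns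
  have hK : Module.Injective R (ℕ → E) := by
    refine ⟨fun X Y _ _ _ _ f hf g => ?_⟩
    choose k hk using fun n => hE.out f hf (LinearMap.proj n ∘ₗ g)
    exact ⟨LinearMap.pi k, fun x => funext fun n => hk n x⟩
  have hKns : IsNonsingularModule R (ℕ → E) := fun x hx => funext fun n =>
    hEns _ (aux_ann_le (LinearMap.proj (R := R) (φ := fun _ : ℕ => E) n) x hx)
  have hNns : IsNonsingularModule R (M × (ℕ → E)) := fun x hx => Prod.ext
    (hns _ (aux_ann_le (LinearMap.fst R M (ℕ → E)) x hx))
    (hKns _ (aux_ann_le (LinearMap.snd R M (ℕ → E)) x hx))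
  have hKB : IsBaerModule R (ℕ → E) := aux_baer hKns fun D hD =>
    aux_retr_of_extending (aux_extending_of_injective hK) hD
  have hNB : IsBaerModule R (M × (ℕ → E)) := aux_baer hNns fun D hD =>
    aux_retr_prod hext hK hD
  let c : (n : ℕ) → (M × (ℕ → E)) →ₗ[R] E := fun n =>
    Nat.casesOn n (i ∘ₗ LinearMap.fst R M (ℕ → E))
      (fun k => LinearMap.proj k ∘ₗ LinearMap.snd R M (ℕ → E))
  obtain ⟨e⟩ := h (M × (ℕ → E)) (ℕ → E) hNB hKB
    ⟨⟨LinearMap.pi c, by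
      rintro ⟨m, f⟩ ⟨m', f'⟩ hh
      refine Prod.ext (hi (congrFun hh 0)) (funext fun n => congrFun hh (n + 1))⟩,
     ⟨LinearMap.inr R M (ℕ → E), LinearMap.inr_injective⟩⟩
  exact aux_inj_retract hK (e.toLinearMap ∘ₗ LinearMap.inl R M (ℕ → E))
    (LinearMap.fst R M (ℕ → E) ∘ₗ e.symm.toLinearMap) (fun m => by simp)
end

section
/- Let R be a right nonsingular ring such that the right R-module R has finite uniform dimension. The following conditions are equivalent: (a) any pair of Baer right R-modules that are subisomorphic to each other are isomorphic; (b) any pair of Baer right R-modules N and K are isomorphic whenever N is isomorphic to a submodule of K and K is isomorphic to a direct summand of N; (c) R is a semisimple Artinian ring. -/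
universe u v

section Aux

variable {R : Type u} [Ring R]

lemma exists_proj_of_isCompl {M : Type*} [AddCommGroup M] [Module R M] {A B : Submodule R M}
    (h : IsCompl A B) : ∃ p : M →ₗ[R] M, (∀ x, p x ∈ B) ∧ (∀ x, x - p x ∈ A) ∧
      (∀ a ∈ A, p a = 0) ∧ (∀ b ∈ B, p b = b) := by
  let p : M →ₗ[R] M := Submodule.projection _ _ h.symm
  have h1 : ∀ x, p x ∈ B := fun x => Submodule.projection_apply_mem _ _
  have h3 : ∀ a ∈ A, p a = 0 := fun a ha => (Submodule.projection_apply_eq_zero_iff h.symm).2 ha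
  have h4 : ∀ b ∈ B, p b = b := fun b hb => (Submodule.projection_eq_self_iff h.symm _).2 hb
  refine ⟨p, h1, fun x => ?_, h3, h4⟩
  refine (Submodule.projection_apply_eq_zero_iff h.symm).1 ?_
  change p (x - p x) = 0
  rw [map_sub, h4 _ (h1 x), sub_self]

lemma isCompl_ker_of_proj {M : Type*} [AddCommGroup M] [Module R M] {C : Submodule R M}
    (p : M →ₗ[R] M) (h1 : ∀ x, p x ∈ C) (h2 : ∀ c ∈ C, p c = c) :
    IsCompl C (LinearMap.ker p) := by
  constructor
  · rw [Submodule.disjoint_def]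
    intro x hx hk
    rw [← h2 x hx]; exact hk
  · rw [codisjoint_iff, eq_top_iff]
    intro x _
    have : x = p x + (x - p x) := by abel
    rw [this]
    refine Submodule.add_mem_sup (h1 x) ?_
    rw [LinearMap.mem_ker, map_sub, h2 _ (h1 x), sub_self]

/-- `V` meets every nonzero submodule of `L`. -/
def EssIn {M : Type*} [AddCommGroup M] [Module R M] (V L : Submodule R M) : Prop :=
  ∀ X : Submodule R M, X ≤ L → X ⊓ V = ⊥ → X = ⊥

lemma ess_colon {M : Type*} [AddCommGroup M] [Module R M] {V L : Submodule R M}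
    (h : EssIn V L) {x : M} (hx : x ∈ L) :
    IsEssentialIdeal R (V.comap (LinearMap.toSpanSingleton R M x)) := by
  intro J hJ
  have key : J.map (LinearMap.toSpanSingleton R M x) = ⊥ := by
    apply h
    · rintro _ ⟨r, _, rfl⟩
      exact L.smul_mem r hx
    · rw [eq_bot_iff]
      rintro _ ⟨⟨r, hr, rfl⟩, hV⟩
      have : r ∈ J ⊓ V.comap (LinearMap.toSpanSingleton R M x) := ⟨hr, hV⟩
      rw [hJ, Submodule.mem_bot] at this
      simp [this]
  rw [← hJ, eq_comm, inf_eq_left]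
  intro r hr
  have : LinearMap.toSpanSingleton R M x r ∈ J.map (LinearMap.toSpanSingleton R M x) :=
    ⟨r, hr, rfl⟩
  rw [key, Submodule.mem_bot] at this
  rw [Submodule.mem_comap, this]
  exact V.zero_mem

lemma IsEssentialIdeal.mono' {I J : Submodule R R} (h : IsEssentialIdeal R I) (hIJ : I ≤ J) :
    IsEssentialIdeal R J := by
  intro X hX
  apply h
  rw [eq_bot_iff] at hX ⊢
  exact (inf_le_inf_left X hIJ).trans hX

lemma singular_map {M N : Type*} [AddCommGroup M] [Module R M] [AddCommGroup N] [Module R N]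
    (f : M →ₗ[R] N) {m : M} (h : IsSingularElem R m) : IsSingularElem R (f m) := by
  refine IsEssentialIdeal.mono' h ?_
  intro r hr
  simp only [annihilatorOf, LinearMap.mem_ker, LinearMap.toSpanSingleton_apply] at hr ⊢
  rw [← map_smul, hr, map_zero]

lemma singular_of_map {M N : Type*} [AddCommGroup M] [Module R M] [AddCommGroup N] [Module R N]
    (f : M →ₗ[R] N) (hf : Function.Injective f) {m : M} (h : IsSingularElem R (f m)) :
    IsSingularElem R m := by
  refine IsEssentialIdeal.mono' h ?_
  intro r hr
  simp only [annihilatorOf, LinearMap.mem_ker, LinearMap.toSpanSingleton_apply] at hr ⊢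
  apply hf
  rw [map_smul, hr, map_zero]

lemma nonsing_of_inj {M N : Type*} [AddCommGroup M] [Module R M] [AddCommGroup N] [Module R N]
    (f : M →ₗ[R] N) (hf : Function.Injective f) (h : IsNonsingularModule R N) :
    IsNonsingularModule R M := fun m hm => by
  apply hf
  rw [map_zero]
  exact h _ (singular_map f hm)

lemma singular_smul {M : Type*} [AddCommGroup M] [Module R M] {m : M} (h : IsSingularElem R m)
    (r : R) : IsSingularElem R (r • m) := by
  have : EssIn (annihilatorOf R m) (⊤ : Submodule R R) := fun X _ hX => h X hX
  refine IsEssentialIdeal.mono' (ess_colon this (x := r) trivial) ?_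
  intro s hs
  simpa [annihilatorOf, mul_smul] using hs

lemma injective_of_retract {U E : Type u} [AddCommGroup U] [Module R U] [AddCommGroup E]
    [Module R E] (hE : Module.Injective R E) (i : U →ₗ[R] E) (p : E →ₗ[R] U)
    (h : ∀ x, p (i x) = x) : Module.Injective R U where
  out X Y _ _ _ _ f hf g := by
    obtain ⟨k, hk⟩ := hE.out f hf (i ∘ₗ g)
    exact ⟨p ∘ₗ k, fun x => by simp [hk, h]⟩

lemma injective_prod {U E : Type u} [AddCommGroup U] [Module R U] [AddCommGroup E]
    [Module R E] (hU : Module.Injective R U) (hE : Module.Injective R E) :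
    Module.Injective R (U × E) where
  out X Y _ _ _ _ f hf g := by
    obtain ⟨k, hk⟩ := hU.out f hf (LinearMap.fst R U E ∘ₗ g)
    obtain ⟨l, hl⟩ := hE.out f hf (LinearMap.snd R U E ∘ₗ g)
    exact ⟨k.prod l, fun x => by ext <;> simp [hk, hl]⟩

lemma injective_pi_nat {E : Type u} [AddCommGroup E]
    [Module R E] (hE : Module.Injective R E) :
    Module.Injective R (ℕ → E) where
  out X Y _ _ _ _ f hf g := by
    choose k hk using fun n : ℕ => hE.out f hf (LinearMap.proj n ∘ₗ g)
    exact ⟨LinearMap.pi k, fun x => by ext n; simp [hk]⟩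

lemma injective_submodule_summand {M : Type u} [AddCommGroup M] [Module R M] (A : Submodule R M)
    (hA : Module.Injective R A) : ∃ B, IsCompl A B := by
  obtain ⟨p, hp⟩ := hA.out A.subtype A.injective_subtype LinearMap.id
  refine ⟨_, isCompl_ker_of_proj (A.subtype ∘ₗ p) (fun x => (p x).2) fun c hc => ?_⟩
  have := hp ⟨c, hc⟩
  simp only [Submodule.subtype_apply] at this
  simp [this]

lemma injective_of_summand {M : Type u} [AddCommGroup M] [Module R M] (A B : Submodule R M)
    (hM : Module.Injective R M) (h : IsCompl A B) : Module.Injective R A := by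
  obtain ⟨p, h1, h2, h3, h4⟩ := exists_proj_of_isCompl h.symm
  refine injective_of_retract hM A.subtype (p.codRestrict A h1) fun x => ?_
  ext
  simp [h4 _ x.2]

lemma exists_max_disjoint {M : Type*} [AddCommGroup M] [Module R M] (C : Submodule R M) :
    ∃ P : Submodule R M, P ⊓ C = ⊥ ∧ ∀ Y, P ≤ Y → Y ⊓ C = ⊥ → Y ≤ P := by
  obtain ⟨m, -, hm⟩ := zorn_le_nonempty₀ {P : Submodule R M | P ⊓ C = ⊥} (by
    intro c hc hch y hy
    refine ⟨sSup c, ?_, fun z hz => le_sSup hz⟩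
    change sSup c ⊓ C = ⊥
    rw [hch.directedOn.sSup_inf_eq]
    simp only [iSup_eq_bot]
    exact fun i hi => hc hi) ⊥ (by simp)
  exact ⟨m, hm.1, fun Y h1 h2 => hm.2 h2 h1⟩

lemma closed_summand {I : Type u} [AddCommGroup I] [Module R I] (hI : Module.Injective R I)
    (C : Submodule R I) (hC : ∀ L, C ≤ L → EssIn C L → L ≤ C) : ∃ D, IsCompl C D := by
  obtain ⟨P, hP, hmax⟩ := exists_max_disjoint C
  have hinj : Function.Injective (P.mkQ ∘ₗ C.subtype) := by
    rw [← LinearMap.ker_eq_bot, eq_bot_iff]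
    intro x hx
    have hxP : (x : I) ∈ P ⊓ C := ⟨by simpa using hx, x.2⟩
    rw [hP] at hxP
    simpa using hxP
  obtain ⟨h, hh⟩ := hI.out _ hinj C.subtype
  have hC' : ∀ c ∈ C, h (P.mkQ c) = c := fun c hc => hh ⟨c, hc⟩
  have hL : LinearMap.range h ≤ C := by
    apply hC
    · intro c hc
      exact ⟨_, hC' c hc⟩
    · intro Z hZ hZC
      have hY : Z.comap (h ∘ₗ P.mkQ) ≤ P := by
        apply hmax
        · intro x hx
          have : P.mkQ x = 0 := by simpa using hx
          simp only [Submodule.mem_comap, LinearMap.comp_apply, this, map_zero, Z.zero_mem]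
        · rw [eq_bot_iff]
          rintro y ⟨hy, hyC⟩
          have h1 : h (P.mkQ y) ∈ Z := hy
          rw [hC' y hyC] at h1
          have : y ∈ Z ⊓ C := ⟨h1, hyC⟩
          rwa [hZC] at this
      rw [eq_bot_iff]
      intro z hz
      obtain ⟨q, rfl⟩ := hZ hz
      obtain ⟨y, rfl⟩ := P.mkQ_surjective q
      have hyP : y ∈ P := hY hz
      have : P.mkQ y = 0 := by simpa using hyP
      simp [this]
  exact ⟨_, isCompl_ker_of_proj (h ∘ₗ P.mkQ) (fun x => hL ⟨_, rfl⟩) hC'⟩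

lemma exists_max_ess {M : Type*} [AddCommGroup M] [Module R M] (V : Submodule R M) :
    ∃ E : Submodule R M, V ≤ E ∧ EssIn V E ∧ ∀ L, E ≤ L → EssIn E L → L ≤ E := by
  obtain ⟨m, hVm, hm⟩ := zorn_le_nonempty₀ {P : Submodule R M | EssIn V P} (by
    intro c hc hch y hy
    refine ⟨sSup c, ?_, fun z hz => le_sSup hz⟩
    intro X hX hXV
    have : X = X ⊓ sSup c := (inf_eq_left.2 hX).symm
    rw [this, hch.directedOn.inf_sSup_eq]
    simp only [iSup_eq_bot]
    intro i hi
    apply hc hi _ inf_le_right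
    rw [eq_bot_iff, ← hXV]
    exact inf_le_inf_right _ inf_le_left) V (by
      intro X h1 h2
      rwa [inf_eq_left.2 h1] at h2)
  refine ⟨m, hVm, hm.1, fun L h1 h2 => hm.2 ?_ h1⟩
  intro X hX hXV
  apply h2 X hX
  apply hm.1 _ inf_le_right
  rw [eq_bot_iff, ← hXV]
  exact inf_le_inf_right _ inf_le_left

lemma exists_injective_nonsing (hns : IsNonsingularModule R R) :
    ∃ (H : Type u) (_ : AddCommGroup H) (_ : Module R H), Module.Injective R H ∧
      IsNonsingularModule R H ∧ ∃ f : R →ₗ[R] H, Function.Injective f := by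
  obtain ⟨J⟩ := CategoryTheory.EnoughInjectives.presentation (ModuleCat.of R R)
  have hJ : CategoryTheory.Injective (ModuleCat.of R J.J) := J.injective
  have hI : Module.Injective R J.J := Module.injective_module_of_injective_object R J.J
  let f : R →ₗ[R] J.J := J.f.hom
  have hf : Function.Injective f := (ModuleCat.mono_iff_injective J.f).1 J.mono
  obtain ⟨E, hVE, hess, hmax⟩ := exists_max_ess (LinearMap.range f)
  obtain ⟨D, hD⟩ := closed_summand hI E hmax
  refine ⟨E, inferInstance, inferInstance, injective_of_summand E D hI hD, ?_,
    f.codRestrict E (fun x => hVE ⟨x, rfl⟩), ?_⟩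
  · intro m hm
    have hm' : IsSingularElem R (m : J.J) := singular_map E.subtype hm
    have : Submodule.span R {(m : J.J)} = ⊥ := by
      apply hess
      · rw [Submodule.span_singleton_le_iff_mem]; exact m.2
      · rw [eq_bot_iff]
        rintro x ⟨hx, y, rfl⟩
        obtain ⟨r, hr⟩ := Submodule.mem_span_singleton.1 hx
        have h1 := singular_smul hm' r
        rw [hr] at h1
        have := hns _ (singular_of_map f hf h1)
        simp [this]
    simpa using this
  · intro x y hxy
    exact hf (congrArg Subtype.val hxy)

/-- `M / C` is nonsingular. -/
def PureIn {M : Type*} [AddCommGroup M] [Module R M] (C : Submodule R M) : Prop :=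
  ∀ x, IsEssentialIdeal R (C.comap (LinearMap.toSpanSingleton R M x)) → x ∈ C

lemma baer_of_pure_summand {M : Type*} [AddCommGroup M] [Module R M]
    (hM : IsNonsingularModule R M) (h : ∀ C : Submodule R M, PureIn C → ∃ D, IsCompl C D) :
    IsBaerModule R M := by
  intro N
  let C : Submodule R M := ⨅ f : {f : Module.End R M // ∀ x ∈ N, f x = 0}, LinearMap.ker f.1
  have hCmem : ∀ x, x ∈ C ↔ ∀ f : Module.End R M, (∀ x ∈ N, f x = 0) → f x = 0 := by
    intro x
    simp [C, Submodule.mem_iInf]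
  have hpure : PureIn C := by
    intro x hx
    rw [hCmem]
    intro f hf
    apply hM
    refine IsEssentialIdeal.mono' hx ?_
    intro r hr
    have := (hCmem _).1 hr f hf
    simpa [annihilatorOf] using this
  obtain ⟨D, hD⟩ := h C hpure
  obtain ⟨p, h1, h2, h3, h4⟩ := exists_proj_of_isCompl hD
  refine ⟨p, ?_, fun f => ⟨fun hf => ⟨f, ?_⟩, ?_⟩⟩
  · ext x
    exact h4 _ (h1 x)
  · ext x
    have := (hCmem _).1 (h2 x) f hf
    rw [map_sub, sub_eq_zero] at this
    exact this
  · rintro ⟨g, rfl⟩ x hx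
    have : p x = 0 := h3 x ((hCmem x).2 fun f hf => hf x hx)
    simp [this]

lemma pure_summand_of_injective {E : Type u} [AddCommGroup E] [Module R E]
    (hE : Module.Injective R E) (C : Submodule R E) (hC : PureIn C) : ∃ D, IsCompl C D :=
  closed_summand hE C fun _ _ hL x hx => hC x (ess_colon hL hx)

lemma pure_summand_prod {E U : Type u} [AddCommGroup E] [Module R E] [AddCommGroup U] [Module R U]
    (hE : Module.Injective R E) (hU : ∀ A : Submodule R U, A ≠ ⊥ → EssIn A ⊤)
    (C : Submodule R (E × U)) (hC : PureIn C) : ∃ D, IsCompl C D := by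
  let C0 : Submodule R E := C.comap (LinearMap.inl R E U)
  have hC0m : ∀ e, e ∈ C0 ↔ (e, (0 : U)) ∈ C := fun e => Iff.rfl
  have hC0 : PureIn C0 := by
    intro x hx
    apply hC
    refine IsEssentialIdeal.mono' hx ?_
    intro r hr
    simpa [C0] using hr
  obtain ⟨E', hE'⟩ := pure_summand_of_injective hE C0 hC0
  obtain ⟨p, h1, h2, h3, h4⟩ := exists_proj_of_isCompl hE'
  have hdis := Submodule.disjoint_def.1 hE'.disjoint
  by_cases hV : C.map (LinearMap.snd R E U) = ⊥
  · have hz : ∀ x ∈ C, x.2 = 0 := by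
      intro x hx
      have : LinearMap.snd R E U x ∈ C.map (LinearMap.snd R E U) := ⟨x, hx, rfl⟩
      rw [hV] at this
      simpa using this
    refine ⟨E'.prod ⊤, ?_, ?_⟩
    · rw [Submodule.disjoint_def]
      rintro ⟨e, u⟩ hx ⟨hy, -⟩
      have hu : u = 0 := hz _ hx
      subst hu
      have := hdis e hx hy
      simp [this]
    · rw [codisjoint_iff, eq_top_iff]
      rintro ⟨e, u⟩ -
      have : (e, u) = (e - p e, (0 : U)) + (p e, u) := by simp
      rw [this]
      exact Submodule.add_mem_sup (h2 e) ⟨h1 e, trivial⟩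
  · -- the projection of `C` to `U` is essential
    let C' : Submodule R (E × U) := C ⊓ E'.prod ⊤
    have hinj : Function.Injective (LinearMap.snd R E U ∘ₗ C'.subtype) := by
      rw [← LinearMap.ker_eq_bot, eq_bot_iff]
      rintro ⟨⟨e, u⟩, ⟨hx, ⟨hy, hy'⟩⟩⟩ hk
      have hu : u = 0 := hk
      subst hu
      have := hdis e hx hy
      simp [this]
    obtain ⟨ψ, hψ⟩ := hE.out _ hinj (LinearMap.fst R E U ∘ₗ C'.subtype)
    have hψ' : ∀ e u, (e, u) ∈ C → ψ u = p e := by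
      intro e u hx
      have h5 : (p e, u) ∈ C := by
        have : (p e, u) = (e, u) - (e - p e, (0 : U)) := by simp
        rw [this]
        exact C.sub_mem hx (h2 e)
      exact hψ ⟨(p e, u), h5, h1 e, trivial⟩
    have hG : ∀ u, (p (ψ u), u) ∈ C := by
      intro u
      apply hC
      refine IsEssentialIdeal.mono' (ess_colon (hU _ hV) (x := u) trivial) ?_
      rintro r ⟨⟨e, w⟩, hx, hw⟩
      have hw : w = r • u := hw
      subst hw
      change r • (p (ψ u), u) ∈ C
      have h6 : r • (p (ψ u), u) = (e, r • u) - (e - p e, (0 : U)) := by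
        ext
        · simp only [Prod.smul_fst, Prod.fst_sub, sub_sub_cancel]
          rw [← map_smul, ← map_smul, hψ' _ _ hx, h4 _ (h1 e)]
        · simp
      rw [h6]
      exact C.sub_mem hx (h2 e)
    refine ⟨E'.prod ⊥, ?_, ?_⟩
    · rw [Submodule.disjoint_def]
      rintro ⟨e, u⟩ hx ⟨hy, hu⟩
      have hu : u = 0 := hu
      subst hu
      have := hdis e hx hy
      simp [this]
    · rw [codisjoint_iff, eq_top_iff]
      rintro ⟨e, u⟩ -
      set e1 := e - p (ψ u) with he1
      have : (e, u) = ((p (ψ u), u) + (e1 - p e1, (0 : U))) + (p e1, (0 : U)) := by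
        ext
        · simp only [Prod.fst_add, he1]; abel
        · simp
      rw [this]
      exact Submodule.add_mem_sup (C.add_mem (hG u) (h2 e1)) ⟨h1 e1, rfl⟩

lemma greedy {M : Type*} [AddCommGroup M] [Module R M] (hdim : HasFiniteUniformDim R M)
    (S : Submodule R M → Prop) (P0 : Submodule R M) (h0 : S P0)
    (hstep : ∀ P, S P → ∃ D, D ≠ ⊥ ∧ Disjoint P D ∧ S (P ⊔ D)) : False := by
  choose D hD1 hD2 hD3 using hstep
  let Q : ℕ → {P // S P} := fun n => Nat.rec ⟨P0, h0⟩ (fun _ P => ⟨P.1 ⊔ D P.1 P.2, hD3 _ _⟩) n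
  let F : ℕ → Submodule R M := fun n => D (Q n).1 (Q n).2
  have hQ : ∀ n, (Q (n + 1)).1 = (Q n).1 ⊔ F n := fun n => rfl
  apply hdim
  refine ⟨F, fun n => hD1 _ _, ?_⟩
  have hsup : ∀ n, (Finset.range n).sup F ≤ (Q n).1 := by
    intro n
    induction n with
    | zero => simp
    | succ n ih =>
      rw [Finset.range_add_one, Finset.sup_insert, hQ]
      exact sup_le le_sup_right (ih.trans le_sup_left)
  have hind : ∀ n, (Finset.range n).SupIndep F := by
    intro n
    induction n with
    | zero => simp
    | succ n ih =>
      rw [Finset.range_add_one]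
      exact ih.insert ((hD2 _ (Q n).2).symm.mono_right (hsup n))
  rw [iSupIndep_iff_supIndep]
  intro s
  obtain ⟨n, hn⟩ := s.exists_nat_subset_range
  exact (hind n).subset hn

/-- uniform submodule -/
def UnifSub {M : Type*} [AddCommGroup M] [Module R M] (U : Submodule R M) : Prop :=
  U ≠ ⊥ ∧ ∀ A, A ≤ U → A ≠ ⊥ → EssIn A U

lemma exists_uniform {M : Type*} [AddCommGroup M] [Module R M] (hdim : HasFiniteUniformDim R M)
    (A : Submodule R M) (hA : A ≠ ⊥) : ∃ U ≤ A, UnifSub U := by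
  by_contra hcon
  push Not at hcon
  refine greedy hdim (fun P => ∃ B ≤ A, B ≠ ⊥ ∧ Disjoint P B) ⊥ ⟨A, le_rfl, hA, disjoint_bot_left⟩ ?_
  rintro P ⟨B, hBA, hB, hPB⟩
  have := hcon B hBA
  simp only [UnifSub, EssIn] at this
  push Not at this
  obtain ⟨X, hXB, hX, Y, hYB, hYX, hY⟩ := this hB
  refine ⟨X, hX, hPB.mono_right hXB, Y, hYB.trans hBA, hY, ?_⟩
  have hXY : Disjoint X Y := by rw [disjoint_iff, inf_comm]; exact hYX
  rw [Submodule.disjoint_def] at hPB hXY ⊢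
  intro x hx hxY
  obtain ⟨a, ha, b, hb, rfl⟩ := Submodule.mem_sup.1 hx
  have ha0 : a = 0 := hPB a ha (by
    have := B.sub_mem (hYB hxY) (hXB hb)
    simpa using this)
  subst ha0
  rw [zero_add] at hxY ⊢
  exact hXY b hb hxY

lemma UnifSub.mono {M : Type*} [AddCommGroup M] [Module R M] {U A : Submodule R M}
    (hU : UnifSub U) (hA : A ≤ U) (hA0 : A ≠ ⊥) : UnifSub A :=
  ⟨hA0, fun B hB hB0 X hX h => hU.2 B (hB.trans hA) hB0 X (hX.trans hA) h⟩

lemma UnifSub.type {M : Type*} [AddCommGroup M] [Module R M] {U : Submodule R M}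
    (hU : UnifSub U) (A : Submodule R U) (hA : A ≠ ⊥) : EssIn A ⊤ := by
  intro X _ hX
  have inj := Submodule.map_injective_of_injective U.injective_subtype
  apply inj
  rw [Submodule.map_bot]
  refine hU.2 (A.map U.subtype) (Submodule.map_subtype_le _ _) ?_ _
    (Submodule.map_subtype_le _ _) ?_
  · intro h
    apply hA
    apply inj
    rw [h, Submodule.map_bot]
  · rw [← Submodule.map_inf _ U.injective_subtype, hX, Submodule.map_bot]

lemma uniform_injective (hns : IsNonsingularModule R R)
    (hb : ∀ (N : Type u) [AddCommGroup N] [Module R N]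
        (K : Type u) [AddCommGroup K] [Module R K],
        IsBaerModule R N → IsBaerModule R K →
        (∃ f : N →ₗ[R] K, Function.Injective f) →
        IsoToDirectSummand R K N →
        Nonempty (N ≃ₗ[R] K)) (U : Submodule R R) (hU : UnifSub U) : Module.Injective R U := by
  obtain ⟨H, _, _, hH, hHns, f, hf⟩ := exists_injective_nonsing hns
  have hE : Module.Injective R (ℕ → H) := injective_pi_nat hH
  have hEns : IsNonsingularModule R (ℕ → H) := by
    intro m hm
    ext n
    exact hHns _ (singular_map (LinearMap.proj n : (ℕ → H) →ₗ[R] H) hm)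
  have hUns : IsNonsingularModule R U := nonsing_of_inj U.subtype U.injective_subtype hns
  have hNns : IsNonsingularModule R ((ℕ → H) × U) := by
    intro m hm
    ext1
    · exact hEns _ (singular_map (LinearMap.fst R (ℕ → H) U) hm)
    · exact hUns _ (singular_map (LinearMap.snd R (ℕ → H) U) hm)
  have hKB : IsBaerModule R (ℕ → H) :=
    baer_of_pure_summand hEns (pure_summand_of_injective hE)
  have hNB : IsBaerModule R ((ℕ → H) × U) :=
    baer_of_pure_summand hNns (pure_summand_prod hE hU.type)
  let F : ((ℕ → H) × U) →ₗ[R] (ℕ → H) :=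
    LinearMap.pi fun n => Nat.casesOn n (f ∘ₗ U.subtype ∘ₗ LinearMap.snd R (ℕ → H) U)
      (fun k => LinearMap.proj k ∘ₗ LinearMap.fst R (ℕ → H) U)
  have hF : Function.Injective F := by
    rw [← LinearMap.ker_eq_bot, eq_bot_iff]
    rintro ⟨e, u⟩ hx
    have hx : F (e, u) = 0 := hx
    have hx0 : f (u : R) = 0 := congrFun hx 0
    have hxs : ∀ k, e k = 0 := fun k => congrFun hx (k + 1)
    have hu : u = 0 := by
      ext
      apply hf
      simp [hx0]
    have he : e = 0 := funext hxs
    simp [he, hu]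
  have hsum : IsoToDirectSummand R (ℕ → H) ((ℕ → H) × U) :=
    ⟨LinearMap.range (LinearMap.inl R (ℕ → H) U), ⟨_, LinearMap.isCompl_range_inl_inr⟩,
      ⟨LinearEquiv.ofInjective _ LinearMap.inl_injective⟩⟩
  obtain ⟨φ⟩ := hb _ _ hNB hKB ⟨F, hF⟩ hsum
  exact injective_of_retract hE (φ.toLinearMap ∘ₗ LinearMap.inr R (ℕ → H) U)
    (LinearMap.snd R (ℕ → H) U ∘ₗ φ.symm.toLinearMap) fun x => by simp

lemma uniform_atom (hinj : ∀ U : Submodule R R, UnifSub U → Module.Injective R U)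
    (U : Submodule R R) (hU : UnifSub U) : IsAtom U := by
  refine ⟨hU.1, fun A hA => ?_⟩
  by_contra hA0
  obtain ⟨B, hB⟩ := injective_submodule_summand A (hinj A (hU.mono hA.le hA0))
  have h1 : B ⊓ U = ⊥ := by
    apply hU.2 A hA.le hA0 _ inf_le_right
    rw [eq_bot_iff, ← hB.inf_eq_bot]
    exact le_inf inf_le_right (inf_le_left.trans inf_le_left)
  have h2 := sup_inf_assoc_of_le B hA.le
  rw [hB.sup_eq_top, h1, top_inf_eq, sup_bot_eq] at h2
  exact hA.ne h2.symm

lemma injective_sup {M : Type u} [AddCommGroup M] [Module R M] {P U : Submodule R M}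
    (h : Disjoint P U) (hP : Module.Injective R P) (hU : Module.Injective R U) :
    Module.Injective R (P ⊔ U : Submodule R M) := by
  let c := LinearMap.coprod P.subtype U.subtype
  have hc : Function.Injective c := by
    rw [← LinearMap.ker_eq_bot, LinearMap.ker_coprod_of_disjoint_range]
    · simp
    · simpa using h
  have hr : LinearMap.range c = P ⊔ U := by simp [c, LinearMap.range_coprod]
  let e := (LinearEquiv.ofInjective c hc).trans (LinearEquiv.ofEq _ _ hr)
  exact injective_of_retract (injective_prod hP hU) e.symm.toLinearMap e.toLinearMap
    fun x => by simp

lemma semisimple_of_b (hns : IsNonsingularModule R R) (hdim : HasFiniteUniformDim R R)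
    (hb : ∀ (N : Type u) [AddCommGroup N] [Module R N]
        (K : Type u) [AddCommGroup K] [Module R K],
        IsBaerModule R N → IsBaerModule R K →
        (∃ f : N →ₗ[R] K, Function.Injective f) →
        IsoToDirectSummand R K N →
        Nonempty (N ≃ₗ[R] K)) : IsSemisimpleRing R := by
  have hinj := uniform_injective hns hb
  by_contra hss
  refine greedy hdim (fun P => Module.Injective R P ∧ IsSemisimpleModule R P) ⊥ ⟨?_, ?_⟩ ?_
  · exact ⟨fun X Y _ _ _ _ f hf g => ⟨0, fun x => Subsingleton.elim _ _⟩⟩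
  · have : IsSemisimpleModule R (⊥ : Submodule R R) :=
      { exists_isCompl := fun a => ⟨a, by
          have : a = ⊥ := Subsingleton.elim _ _
          have h2 : (⊥ : Submodule R (⊥ : Submodule R R)) = ⊤ := Subsingleton.elim _ _
          rw [this]
          refine ⟨disjoint_bot_left, ?_⟩
          rw [codisjoint_iff, h2]; simp⟩ }
    exact this
  · rintro P ⟨hP, hPs⟩
    obtain ⟨B, hB⟩ := injective_submodule_summand P hP
    have hB0 : B ≠ ⊥ := by
      rintro rfl
      have hT : P = ⊤ := by simpa using hB.sup_eq_top
      subst hT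
      exact hss (IsSemisimpleModule.congr (Submodule.topEquiv (R := R) (M := R)).symm)
    obtain ⟨U, hUB, hU⟩ := exists_uniform hdim B hB0
    have hd : Disjoint P U := hB.disjoint.mono_right hUB
    refine ⟨U, hU.1, hd, injective_sup hd hP (hinj U hU), ?_⟩
    have : IsSimpleModule R U := isSimpleModule_iff_isAtom.2 (uniform_atom hinj U hU)
    exact IsSemisimpleModule.sup hPs inferInstance

lemma bumby [IsSemisimpleRing R] {N K : Type*} [AddCommGroup N] [Module R N]
    [AddCommGroup K] [Module R K] (f : N →ₗ[R] K) (hf : Function.Injective f)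
    (g : K →ₗ[R] N) (hg : Function.Injective g) : Nonempty (N ≃ₗ[R] K) := by
  obtain ⟨X, hX⟩ := exists_isCompl (LinearMap.range g)
  let h : N →ₗ[R] N := g ∘ₗ f
  have hh : Function.Injective h := hg.comp hf
  let V : Submodule R N := ⨆ n : ℕ, X.map (h ^ n)
  have hVX : V ≤ X ⊔ V.map h := by
    apply iSup_le
    intro n
    cases n with
    | zero => simp [Module.End.one_eq_id]
    | succ n =>
      refine le_trans ?_ le_sup_right
      rw [pow_succ', Module.End.mul_eq_comp, Submodule.map_comp (h ^ n) h]
      exact Submodule.map_mono (le_iSup (fun n : ℕ => X.map (h ^ n)) n)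
  have hXV : X ≤ V := by
    refine le_trans ?_ (le_iSup (fun n : ℕ => X.map (h ^ n)) 0)
    simp [Module.End.one_eq_id]
  have hhV : V.map h ≤ V := by
    rw [Submodule.map_iSup]
    apply iSup_le
    intro n
    refine le_trans ?_ (le_iSup (fun n : ℕ => X.map (h ^ n)) (n + 1))
    rw [pow_succ', Module.End.mul_eq_comp, Submodule.map_comp (h ^ n) h]
  have hVr : V.map h ≤ LinearMap.range g := by
    rintro _ ⟨x, -, rfl⟩
    exact ⟨f x, rfl⟩
  obtain ⟨W', hW'⟩ := exists_isCompl (V.map h)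
  let W := W' ⊓ LinearMap.range g
  have hW1 : V.map h ⊔ W = LinearMap.range g := by
    rw [← sup_inf_assoc_of_le W' hVr, hW'.sup_eq_top, top_inf_eq]
  have hW2 : Disjoint (V.map h) W := hW'.disjoint.mono_right inf_le_left
  have hc : IsCompl V W := by
    constructor
    · rw [Submodule.disjoint_def] at hW2 ⊢
      intro v hv hw
      obtain ⟨x, hx, y, hy, rfl⟩ := Submodule.mem_sup.1 (hVX hv)
      have hx0 : x = 0 := by
        refine (Submodule.disjoint_def.1 hX.disjoint) x ?_ hx
        have := (LinearMap.range g).sub_mem hw.2 (hVr hy)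
        simpa using this
      subst hx0
      rw [zero_add] at hw ⊢
      exact hW2 y hy hw
    · rw [codisjoint_iff, eq_top_iff, ← hX.sup_eq_top, ← hW1]
      exact sup_le (sup_le (hhV.trans le_sup_left) le_sup_right) (hXV.trans le_sup_left)
  let c := LinearMap.coprod (h ∘ₗ V.subtype) W.subtype
  have hr1 : LinearMap.range (h ∘ₗ V.subtype) = V.map h := by
    rw [LinearMap.range_comp, Submodule.range_subtype]
  have hcinj : Function.Injective c := by
    rw [← LinearMap.ker_eq_bot, LinearMap.ker_coprod_of_disjoint_range]
    · rw [(LinearMap.ker_eq_bot (f := h ∘ₗ V.subtype)).2 (hh.comp V.injective_subtype), Submodule.ker_subtype,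
        Submodule.prod_bot]
    · rw [hr1, Submodule.range_subtype]; exact hW2
  have hr : LinearMap.range c = LinearMap.range g := by
    rw [LinearMap.range_coprod, hr1, Submodule.range_subtype, hW1]
  exact ⟨(Submodule.prodEquivOfIsCompl V W hc).symm.trans
    ((LinearEquiv.ofInjective c hcinj).trans ((LinearEquiv.ofEq _ _ hr).trans
      (LinearEquiv.ofInjective g hg).symm))⟩

end Aux


/-- For a right nonsingular ring `R` of finite uniform dimension,
the following are equivalent:
(a) any pair of mutually subisomorphic Baer `R`-modules are isomorphic;
(b) any pair of Baer `R`-modules `N`, `K` are isomorphic whenever `N` embeds in `K`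
    and `K` is isomorphic to a direct summand of `N`;
(c) `R` is a semisimple Artinian ring. -/
theorem baer_SB_iff_semisimple
    (R : Type u) [Ring R]
    (hns : IsNonsingularModule R R)
    (hdim : HasFiniteUniformDim R R) :
    ((∀ (N : Type u) [AddCommGroup N] [Module R N]
        (K : Type u) [AddCommGroup K] [Module R K],
        IsBaerModule R N → IsBaerModule R K → Subisomorphic R N K →
        Nonempty (N ≃ₗ[R] K)) ↔
      (∀ (N : Type u) [AddCommGroup N] [Module R N]
        (K : Type u) [AddCommGroup K] [Module R K],
        IsBaerModule R N → IsBaerModule R K →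
        (∃ f : N →ₗ[R] K, Function.Injective f) →
        IsoToDirectSummand R K N →
        Nonempty (N ≃ₗ[R] K))) ∧
    ((∀ (N : Type u) [AddCommGroup N] [Module R N]
        (K : Type u) [AddCommGroup K] [Module R K],
        IsBaerModule R N → IsBaerModule R K →
        (∃ f : N →ₗ[R] K, Function.Injective f) →
        IsoToDirectSummand R K N →
        Nonempty (N ≃ₗ[R] K)) ↔
      IsSemisimpleRing R) := by
  have hab : (∀ (N : Type u) [AddCommGroup N] [Module R N]
        (K : Type u) [AddCommGroup K] [Module R K],
        IsBaerModule R N → IsBaerModule R K → Subisomorphic R N K →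
        Nonempty (N ≃ₗ[R] K)) →
      (∀ (N : Type u) [AddCommGroup N] [Module R N]
        (K : Type u) [AddCommGroup K] [Module R K],
        IsBaerModule R N → IsBaerModule R K →
        (∃ f : N →ₗ[R] K, Function.Injective f) →
        IsoToDirectSummand R K N →
        Nonempty (N ≃ₗ[R] K)) := by
    intro ha N _ _ K _ _ hN hK hf ⟨L, _, ⟨e⟩⟩
    exact ha N K hN hK ⟨hf, L.subtype ∘ₗ e.toLinearMap, L.injective_subtype.comp e.injective⟩
  have hca : IsSemisimpleRing R → (∀ (N : Type u) [AddCommGroup N] [Module R N]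
        (K : Type u) [AddCommGroup K] [Module R K],
        IsBaerModule R N → IsBaerModule R K → Subisomorphic R N K →
        Nonempty (N ≃ₗ[R] K)) := by
    intro hs N _ _ K _ _ _ _ ⟨⟨f, hf⟩, ⟨g, hg⟩⟩
    exact bumby f hf g hg
  exact ⟨⟨hab, fun hb => hca (semisimple_of_b hns hdim hb)⟩,
    ⟨semisimple_of_b hns hdim, fun hs => hab (hca hs)⟩⟩
end

section
/- Let R be a ring. Every Baer right R-module is injective if and only if R is a semisimple Artinian ring. -/
universe u v

theorem baer_of_semisimple (R : Type u) [Ring R] (M : Type v) [AddCommGroup M] [Module R M]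
    [IsSemisimpleModule R M] : IsBaerModule R M := by
  intro N
  obtain ⟨N', h⟩ := exists_isCompl N
  obtain ⟨π, hπ⟩ : ∃ π : M →ₗ[R] N, ∀ x : N, π x = x :=
    ⟨N.projectionOnto N' h, fun x => by simp⟩
  · have hp : ∀ x ∈ N, (π x : M) = x := by
      intro x hx
      exact congrArg Subtype.val (hπ ⟨x, hx⟩)
    refine ⟨1 - N.subtype ∘ₗ π, ?_, ?_⟩
    · ext x
      simp [hp]
    · intro f
      constructor
      · intro hf
        refine ⟨f, ?_⟩
        ext x
        simp [hf]
      · rintro ⟨g, rfl⟩ x hx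
        simp [hp x hx]

theorem exists_mono (R : Type u) [Ring R] (M : Type v) [AddCommGroup M] [Module R M]
    [IsNoetherian R M] [Nontrivial M] : ∃ B : Submodule R M, B ≠ ⊥ ∧
      ∀ (C : Submodule R M) (h : C →ₗ[R] M), C ≤ B → LinearMap.range h ≤ B →
        h = 0 ∨ LinearMap.ker h = ⊥ := by
  let T : Set (Submodule R M) := {K | ∃ (A : Submodule R M) (g : A →ₗ[R] M), g ≠ 0 ∧
    K = (LinearMap.ker g).map A.subtype}
  have hT : T.Nonempty := by
    refine ⟨_, ⊤, (⊤ : Submodule R M).subtype, ?_, rfl⟩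
    intro h
    obtain ⟨x, hx⟩ := exists_ne (0 : M)
    exact hx (by simpa using LinearMap.congr_fun h ⟨x, trivial⟩)
  obtain ⟨K, ⟨A, g, hg, rfl⟩, hmax⟩ := set_has_maximal_iff_noetherian.mpr ‹_› T hT
  refine ⟨LinearMap.range g, by simpa [LinearMap.range_eq_bot] using hg, ?_⟩
  intro C h hC hh
  by_contra hcon
  push Not at hcon
  obtain ⟨h0, hk⟩ := hcon
  -- the preimage of C
  let A' : Submodule R M := (C.comap g).map A.subtype
  have hA' : A' ≤ A := by
    rintro _ ⟨a, _, rfl⟩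
    exact a.2
  let q0 : A' →ₗ[R] M := g ∘ₗ Submodule.inclusion hA'
  have hq : ∀ a : A', q0 a ∈ C := by
    rintro ⟨_, a, ha, rfl⟩
    exact ha
  let q : A' →ₗ[R] C := q0.codRestrict C hq
  have hqv : ∀ (a : A) (ha : (a : M) ∈ A'), (q ⟨a, ha⟩ : M) = g a := fun a ha => rfl
  have hlift : ∀ c : C, ∃ (a : A) (ha : (a : M) ∈ A'), q ⟨a, ha⟩ = c := by
    intro c
    obtain ⟨a, ha⟩ := hC c.2
    refine ⟨a, ⟨a, ?_, rfl⟩, Subtype.ext ha⟩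
    change g a ∈ C
    rw [ha]
    exact c.2
  refine hmax ((LinearMap.ker (h ∘ₗ q)).map A'.subtype) ⟨A', h ∘ₗ q, ?_, rfl⟩ ?_
  · intro hz
    apply h0
    ext c
    obtain ⟨a, ha, rfl⟩ := hlift c
    simpa using LinearMap.congr_fun hz ⟨a, ha⟩
  · refine lt_of_le_of_ne ?_ ?_
    · rintro _ ⟨a, ha, rfl⟩
      have ha0 : g a = 0 := ha
      have hm : (a : M) ∈ A' := ⟨a, by change g a ∈ C; rw [ha0]; exact C.zero_mem, rfl⟩
      refine ⟨⟨a, hm⟩, ?_, rfl⟩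
      have : q ⟨a, hm⟩ = 0 := Subtype.ext ha0
      change h (q ⟨a, hm⟩) = 0
      rw [this, map_zero]
    · intro heq
      apply hk
      rw [eq_bot_iff]
      intro c hc
      obtain ⟨a, ha, rfl⟩ := hlift c
      have h1 : (a : M) ∈ (LinearMap.ker (h ∘ₗ q)).map A'.subtype := ⟨⟨a, ha⟩, hc, rfl⟩
      rw [← heq] at h1
      obtain ⟨b, hb, hba⟩ := h1
      have : b = a := Subtype.ext hba
      subst this
      exact Subtype.ext hb

theorem exists_atom_of_baer_injective (R : Type u) [Ring R]
    (H : ∀ (M : Type u) [AddCommGroup M] [Module R M],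
      IsBaerModule R M → Module.Injective R M)
    (M : Type u) [AddCommGroup M] [Module R M]
    [IsNoetherian R M] [Nontrivial M] : ∃ B : Submodule R M, IsAtom B := by
  obtain ⟨B, hB, hmono⟩ := exists_mono R M
  have key : ∀ C ≤ B, C ≠ ⊥ → C = B := by
    intro C hC hC0
    have hbaer : IsBaerModule R C := by
      intro N
      by_cases hN : N = ⊥
      · subst hN
        exact ⟨1, IsIdempotentElem.one, fun f => ⟨fun _ => ⟨f, by simp⟩, by simp⟩⟩
      · refine ⟨0, IsIdempotentElem.zero, fun f => ⟨fun hf => ⟨0, ?_⟩, ?_⟩⟩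
        · rcases hmono C (C.subtype ∘ₗ f) hC (by
            rintro _ ⟨x, rfl⟩
            exact hC (f x).2) with h | h
          · ext x
            simpa using LinearMap.congr_fun h x
          · exfalso
            apply hN
            rw [eq_bot_iff, ← h]
            intro x hx
            simp [hf x hx]
        · rintro ⟨g, rfl⟩ x _
          simp
    obtain ⟨p, hp⟩ := (H C hbaer).out C.subtype C.injective_subtype LinearMap.id
    rcases hmono B (C.subtype ∘ₗ p ∘ₗ B.subtype) le_rfl (by
        rintro _ ⟨x, rfl⟩
        exact hC (p x).2) with h | h
    · exfalso
      apply hC0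
      rw [eq_bot_iff]
      intro c hc
      have h1 := LinearMap.congr_fun h ⟨c, hC hc⟩
      have h2 := hp ⟨c, hc⟩
      simp at h1 h2
      rw [h1] at h2
      simpa using (congrArg Subtype.val h2).symm
    · refine le_antisymm hC fun b hb => ?_
      have hinj := LinearMap.ker_eq_bot.mp h
      have : (⟨b, hb⟩ : B) = ⟨p b, hC (p b).2⟩ := by
        apply hinj
        have := hp (p b)
        simp at this
        simp [this]
      have := congrArg Subtype.val this
      simp only at this
      rw [this]
      exact (p b).2
  refine ⟨B, hB, fun C hC => ?_⟩
  by_contra h0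
  exact hC.ne (key C hC.le h0)

theorem noetherian_of_baer_injective (R : Type u) [Ring R]
    (H : ∀ (M : Type u) [AddCommGroup M] [Module R M],
      IsBaerModule R M → Module.Injective R M) : IsNoetherian R R := by
  have V : ∀ (I : Submodule R R) (x : R), x ∉ I → ∃ (m : Submodule R R) (f : R →ₗ[R] (R ⧸ m)),
      IsSimpleModule R (R ⧸ m) ∧ (∀ y ∈ I, f y = 0) ∧ f x ≠ 0 := by
    intro I x hx
    let t : R →ₗ[R] (R ⧸ I) := LinearMap.toSpanSingleton R (R ⧸ I) (I.mkQ x)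
    have ht1 : t 1 = I.mkQ x := by simp [t]
    have hJ : LinearMap.ker t ≠ ⊤ := by
      intro h
      have : (1 : R) ∈ LinearMap.ker t := by rw [h]; trivial
      rw [LinearMap.mem_ker, ht1] at this
      exact hx (by simpa using this)
    obtain ⟨m, hm, hle⟩ := Ideal.exists_le_maximal (LinearMap.ker t) hJ
    have hs : IsSimpleModule R (R ⧸ (m : Submodule R R)) :=
      isSimpleModule_iff_isCoatom.mpr hm.out
    have hinj := H (R ⧸ (m : Submodule R R)) (baer_of_semisimple R _)
    obtain ⟨h, hh⟩ := hinj.out ((LinearMap.ker t).liftQ t le_rfl)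
      (LinearMap.ker_eq_bot.mp (Submodule.ker_liftQ_eq_bot _ _ _ le_rfl))
      (Submodule.factor hle)
    refine ⟨m, h ∘ₗ I.mkQ, hs, ?_, ?_⟩
    · intro y hy
      have : I.mkQ y = 0 := by simpa using hy
      rw [LinearMap.comp_apply, this, map_zero]
    · have h1 := hh ((LinearMap.ker t).mkQ 1)
      simp only [Submodule.mkQ_apply, Submodule.liftQ_apply, ht1] at h1
      rw [LinearMap.comp_apply, Submodule.mkQ_apply, h1]
      intro h0
      have h0 : (Submodule.Quotient.mk 1 : R ⧸ (m : Submodule R R)) = 0 := h0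
      rw [Submodule.Quotient.mk_eq_zero] at h0
      exact hm.ne_top ((Ideal.eq_top_iff_one m).mpr h0)
  rw [← monotone_stabilizes_iff_noetherian]
  intro I
  by_contra hcon
  push Not at hcon
  have hx : ∀ n, ∃ x ∈ (⨆ k, I k), x ∉ I n := by
    intro n
    obtain ⟨k, hk, hne⟩ := hcon n
    have : ¬ I k ≤ I n := fun h => hne (le_antisymm (I.monotone hk) h)
    obtain ⟨x, hx, hxn⟩ := Set.not_subset.mp this
    exact ⟨x, le_iSup I k hx, hxn⟩
  choose x hxU hxI using hx
  choose m f hs hf0 hfx using fun n => V (I n) (x n) (hxI n)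
  have hd : ∀ u : ↥(⨆ k, I k), ∃ d : Π₀ n, R ⧸ m n, ∀ n, d n = f n u := by
    rintro ⟨u, hu⟩
    obtain ⟨k, hk⟩ := (Submodule.mem_iSup_of_chain I u).mp hu
    refine ⟨DFinsupp.mk (Finset.range k) (fun n => f n u), fun n => ?_⟩
    rw [DFinsupp.mk_apply]
    split_ifs with h
    · rfl
    · rw [hf0 n u]
      exact I.monotone (by simpa using h) hk
  choose d hd using hd
  let D : ↥(⨆ k, I k) →ₗ[R] Π₀ n, R ⧸ m n :=
    { toFun := d
      map_add' := fun a b => by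
        ext n
        simp [hd]
      map_smul' := fun r a => by
        ext n
        simp only [hd, DFinsupp.smul_apply, RingHom.id_apply, Submodule.coe_smul, map_smul] }
  obtain ⟨h, hh⟩ := (H (Π₀ n, R ⧸ m n) (baer_of_semisimple R _)).out
    (⨆ k, I k).subtype (Submodule.injective_subtype _) D
  classical
  obtain ⟨n, hn⟩ := Infinite.exists_notMem_finset (h 1).support
  have h1 : (h 1) n = 0 := by simpa using hn
  apply hfx n
  have h2 := hh ⟨x n, hxU n⟩
  have h3 : D ⟨x n, hxU n⟩ n = f n (x n) := hd _ n
  rw [← h3, ← h2]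
  have h4 : (⨆ k, I k).subtype ⟨x n, hxU n⟩ = x n • (1 : R) := by simp
  rw [h4, map_smul, DFinsupp.smul_apply, h1, smul_zero]

/-- Every Baer `R`-module is injective iff `R` is semisimple Artinian. -/
theorem every_baer_injective_iff_semisimple (R : Type u) [Ring R] :
    (∀ (M : Type u) [AddCommGroup M] [Module R M],
      IsBaerModule R M → Module.Injective R M) ↔
    IsSemisimpleRing R := by
  constructor
  · intro H
    have hN := noetherian_of_baer_injective R H
    let T : Set (Submodule R R) := {K | IsSemisimpleModule R K}
    have hT : T.Nonempty := ⟨⊥, by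
      change IsSemisimpleModule R (⊥ : Submodule R R)
      exact (isSemisimpleModule_iff R _).mpr Subsingleton.instComplementedLattice⟩
    obtain ⟨K, hK, hmax⟩ := set_has_maximal_iff_noetherian.mpr hN T hT
    have hK' : IsSemisimpleModule R K := hK
    obtain ⟨p, hp⟩ := (H K (baer_of_semisimple R K)).out K.subtype K.injective_subtype
      LinearMap.id
    have hc : IsCompl K (LinearMap.ker p) := LinearMap.isCompl_of_proj hp
    by_cases hb : LinearMap.ker p = ⊥
    · rw [hb] at hc
      have hKt : K = ⊤ := by simpa using hc.sup_eq_top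
      subst hKt
      exact hK'.congr Submodule.topEquiv.symm
    · have := (Submodule.nontrivial_iff_ne_bot).mpr hb
      obtain ⟨B, hB⟩ := exists_atom_of_baer_injective R H (LinearMap.ker p)
      have hBs : IsSimpleModule R B := isSimpleModule_iff_isAtom.mpr hB
      let B' := B.map (LinearMap.ker p).subtype
      have hB' : IsSemisimpleModule R B' :=
        IsSemisimpleModule.congr (Submodule.equivMapOfInjective _
          (Submodule.injective_subtype _) B).symm
      exfalso
      refine hmax (K ⊔ B') (hK'.sup hB') (lt_of_le_of_ne le_sup_left fun he => ?_)
      have h1 : B' ≤ K := by rw [he]; exact le_sup_right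
      have h2 : B' ≤ LinearMap.ker p := Submodule.map_subtype_le _ _
      have h3 : B' = ⊥ := by
        rw [eq_bot_iff, ← hc.inf_eq_bot]
        exact le_inf h1 h2
      apply hB.1
      exact Submodule.map_injective_of_injective (Submodule.injective_subtype _)
        (h3.trans (Submodule.map_bot _).symm)
  · intro _ M _ _ _
    exact Module.injective_of_isSemisimpleRing R M
end
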